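/- Let Φ be a real M×n matrix with ΦᵀΦ invertible, let θ* ∈ ℝ^n and Δ ∈ ℝ^M with Φᵀ Δ = 0 and ‖Φ θ*‖₂ > ‖Δ‖₂. Then: (i) the pair (θ̂, F) = (0, Φ θ* + Δ) satisfies the standard additive recovery equation Φ θ* + Δ = Φ θ̂ + F and its baseline parameter error equals ‖θ*‖₂ > 0; (ii) every pair (θ̂, F) satisfying the orthogonal-by-construction recovery equation Φ θ* + Δ = Φ θ̂ + (I_M − Φ(ΦᵀΦ)⁻¹Φᵀ) F has baseline parameter error ‖θ* − θ̂‖₂ = 0. Hence the worst-case baseline error of the standard additive structure strictly exceeds that of the orthogonal-by-construction structure. -/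

import Mathlib

open Matrix

/-- The Euclidean (ℓ²) norm of a finite real vector. -/
noncomputable def euclNorm {k : ℕ} (v : Fin k → ℝ) : ℝ :=
  ‖(WithLp.equiv 2 (Fin k → ℝ)).symm v‖

theorem euclNorm_zero {k : ℕ} : euclNorm (0 : Fin k → ℝ) = 0 := by
  simp [euclNorm]

theorem euclNorm_nonneg {k : ℕ} (v : Fin k → ℝ) : 0 ≤ euclNorm v :=
  norm_nonneg _

theorem euclNorm_pos {k : ℕ} {v : Fin k → ℝ} (hv : v ≠ 0) : 0 < euclNorm v := by
  simpa [euclNorm] using hv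

theorem transpose_mul_orth_projection {m n R : Type*} [Fintype m] [Fintype n] [DecidableEq m]
    [DecidableEq n] [CommRing R] (A : Matrix m n R) (h : IsUnit (Aᵀ * A)) :
    Aᵀ * (1 - A * (Aᵀ * A)⁻¹ * Aᵀ) = 0 := by
  rw [Matrix.mul_sub, Matrix.mul_one, ← Matrix.mul_assoc, ← Matrix.mul_assoc,
    Matrix.mul_nonsing_inv _ ((Matrix.isUnit_iff_isUnit_det _).mp h), Matrix.one_mul, sub_self]

/-- With ΦᵀΦ invertible, Φᵀ Δ = 0 and ‖Φ θ*‖₂ > ‖Δ‖₂: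
(i) the pair (θ̂, F) = (0, Φ θ* + Δ) satisfies the standard additive recovery equation
Φ θ* + Δ = Φ θ̂ + F, and its baseline parameter error equals ‖θ*‖₂, which is positive;
(ii) every pair (θ̂, F) satisfying the orthogonal-by-construction recovery equation
Φ θ* + Δ = Φ θ̂ + (I − Φ(ΦᵀΦ)⁻¹Φᵀ) F has baseline error ‖θ* − θ̂‖₂ = 0.
Hence the worst-case baseline error of the standard additive structure strictly
exceeds that of the orthogonal-by-construction structure. -/
theorem standard_additive_worse_than_orth_param
    (M n : ℕ) (Φ : Matrix (Fin M) (Fin n) ℝ)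
    (hinv : IsUnit (Φᵀ * Φ))
    (θstar : Fin n → ℝ) (Δ : Fin M → ℝ)
    (horth : Φᵀ.mulVec Δ = 0)
    (hdom : euclNorm (Φ.mulVec θstar) > euclNorm Δ) :
    (Φ.mulVec θstar + Δ = Φ.mulVec (0 : Fin n → ℝ) + (Φ.mulVec θstar + Δ) ∧
      euclNorm (θstar - (0 : Fin n → ℝ)) = euclNorm θstar ∧ 0 < euclNorm θstar) ∧
    (∀ (θhat : Fin n → ℝ) (F : Fin M → ℝ),
      Φ.mulVec θstar + Δ
        = Φ.mulVec θhat + (1 - Φ * (Φᵀ * Φ)⁻¹ * Φᵀ).mulVec F →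
      euclNorm (θstar - θhat) = 0) := by
  refine ⟨⟨by simp, by simp, euclNorm_pos ?_⟩, fun θhat F h => ?_⟩
  · rintro rfl
    rw [Matrix.mulVec_zero, euclNorm_zero] at hdom
    exact absurd (euclNorm_nonneg Δ) (not_le.mpr hdom)
  · have key := congrArg (Φᵀ *ᵥ ·) h
    simp only [Matrix.mulVec_add, Matrix.mulVec_mulVec, horth,
      transpose_mul_orth_projection Φ hinv, Matrix.zero_mulVec, add_zero] at key
    rw [Matrix.mulVec_injective_of_isUnit hinv key, sub_self, euclNorm_zero]
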